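/- Let s > 0, max(1/2, 1−s) < θ < 1, and 0 ≤ ε ≤ 1−θ. There is a constant C such that for all Schwartz functions φ, ψ on ℝ^{1+2}, ‖D_+φ · D_−ψ‖_{H^{s,θ−1+ε}} ≤ C·‖φ‖_{𝓗^{s+1,θ}}·‖ψ‖_{𝓗^{s+1,θ}}, where D_+ and D_− are the space-time Fourier multiplier operators with symbols |τ| + |ξ| and ||τ| − |ξ|| respectively. -/

import Mathlib

noncomputable section

open MeasureTheory Real
open scoped ENNReal RealInnerProductSpace

/-- The spatial domain `ℝ²`. -/
abbrev V2 : Type := EuclideanSpace ℝ (Fin 2)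

/-- Space-time Fourier transform on `ℝ^{1+2}`, convention `e^{-i(tτ + x·ξ)}`. -/
def ftST (u : ℝ × V2 → ℂ) (τ : ℝ) (ξ : V2) : ℂ :=
  ∫ p : ℝ × V2, Complex.exp (-Complex.I * ((p.1 * τ + ⟪p.2, ξ⟫ : ℝ) : ℂ)) * u p

/-- The weight `(1+|ξ|²)^{s/2} (1+||τ|-|ξ||)^θ`. -/
def wgt (s θ τ : ℝ) (ξ : V2) : ℝ :=
  (1 + ‖ξ‖ ^ 2) ^ (s / 2) * (1 + |(|τ| - ‖ξ‖)|) ^ θ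

/-- The Wave–Sobolev norm `H^{s,θ}` on `ℝ^{1+2}`. -/
def HN (s θ : ℝ) (u : ℝ × V2 → ℂ) : ℝ≥0∞ :=
  (∫⁻ q : ℝ × V2, (ENNReal.ofReal (wgt s θ q.1 q.2) * (‖ftST u q.1 q.2‖₊ : ℝ≥0∞)) ^ (2 : ℕ)) ^
    ((1 : ℝ) / 2)

/-- Time derivative `∂ₜ u`. -/
def dtime (u : ℝ × V2 → ℂ) : ℝ × V2 → ℂ :=
  fun p => fderiv ℝ u p ((1 : ℝ), (0 : V2))

/-- The norm of `𝓗^{s,θ}`: `‖u‖_{H^{s,θ}} + ‖∂ₜu‖_{H^{s-1,θ}}`. -/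
def HHN (s θ : ℝ) (u : ℝ × V2 → ℂ) : ℝ≥0∞ :=
  HN s θ u + HN (s - 1) θ (dtime u)

/-- Spatial partial derivative `∂ⱼ u`, `j = 0, 1`. -/
def pdx (j : Fin 2) (u : ℝ × V2 → ℂ) : ℝ × V2 → ℂ :=
  fun p => fderiv ℝ u p ((0 : ℝ), EuclideanSpace.single j 1)

/-- Inverse space-time Fourier transform. -/
def iftST (F : ℝ → V2 → ℂ) (t : ℝ) (x : V2) : ℂ :=
  ((((2 * π) ^ 3)⁻¹ : ℝ) : ℂ) *
    ∫ q : ℝ × V2, Complex.exp (Complex.I * ((t * q.1 + ⟪x, q.2⟫ : ℝ) : ℂ)) * F q.1 q.2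

/-- The space-time Fourier multiplier with symbol `m`. -/
def mult (m : ℝ → V2 → ℂ) (u : ℝ × V2 → ℂ) : ℝ × V2 → ℂ :=
  fun p => iftST (fun τ ξ => m τ ξ * ftST u τ ξ) p.1 p.2

/-- The multiplier `D₊` with symbol `|τ| + |ξ|`. -/
def Dplus (u : ℝ × V2 → ℂ) : ℝ × V2 → ℂ :=
  mult (fun τ ξ => ((|τ| + ‖ξ‖ : ℝ) : ℂ)) u

/-- The multiplier `D₋` with symbol `||τ| - |ξ||`. -/
def Dminus (u : ℝ × V2 → ℂ) : ℝ × V2 → ℂ :=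
  mult (fun τ ξ => ((|(|τ| - ‖ξ‖)| : ℝ) : ℂ)) u

open FourierTransform

abbrev WW : Type := WithLp 2 (ℝ × V2)

lemma ftST_eq (u : ℝ × V2 → ℂ) (τ : ℝ) (ξ : V2) :
    ftST u τ ξ = 𝓕 (fun w : WW => u (WithLp.ofLp w)) ((2 * π)⁻¹ • WithLp.toLp 2 (τ, ξ)) := by
  rw [Real.fourier_eq', ftST, ← (WithLp.volume_preserving_ofLp ℝ V2).integral_comp
    (MeasurableEquiv.toLp 2 (ℝ × V2)).symm.measurableEmbedding]
  congr 1; ext w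
  simp only [smul_eq_mul]
  congr 2
  rw [inner_smul_right, WithLp.prod_inner_apply]
  have : (2 * π) ≠ 0 := by positivity
  simp only [RCLike.inner_apply, conj_trivial]
  have h : -2 * π * ((2 * π)⁻¹ * (τ * w.fst + ⟪w.snd, ξ⟫)) = -(w.fst * τ + ⟪w.snd, ξ⟫) := by
    field_simp
  change _ = ((-2 * π * ((2 * π)⁻¹ * (τ * w.fst + ⟪w.snd, ξ⟫)) : ℝ) : ℂ) * Complex.I
  rw [h]
  push_cast
  change - Complex.I * ((w.fst : ℂ) * _ + ((⟪w.snd, ξ⟫ : ℝ) : ℂ)) = _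
  ring

lemma iftST_eq (F : ℝ → V2 → ℂ) (p : ℝ × V2) :
    iftST F p.1 p.2 = 𝓕⁻ (fun w : WW => F (2 * π * w.fst) ((2 * π) • w.snd)) (WithLp.toLp 2 p) := by
  rw [Real.fourierInv_eq', iftST, ← (WithLp.volume_preserving_ofLp ℝ V2).integral_comp
    (MeasurableEquiv.toLp 2 (ℝ × V2)).symm.measurableEmbedding]
  have hpi : (0:ℝ) < 2 * π := by positivity
  have := Measure.integral_comp_smul (volume : Measure WW)
    (fun w : WW => Complex.exp (Complex.I * ((p.1 * w.fst + ⟪p.2, w.snd⟫ : ℝ) : ℂ)) * F w.fst w.snd) (2 * π)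
  have hd : Module.finrank ℝ WW = 3 := by
    rw [(WithLp.linearEquiv 2 ℝ (ℝ × V2)).finrank_eq]; simp
  rw [hd, abs_of_pos (by positivity)] at this
  rw [Complex.real_smul] at this
  refine this.symm.trans ?_
  congr 1; ext w
  simp only [smul_eq_mul]
  congr 2
  rw [WithLp.prod_inner_apply]
  simp only [RCLike.inner_apply, conj_trivial]
  rw [WithLp.smul_fst, WithLp.smul_snd, inner_smul_right, real_inner_comm]
  change _ = ((2 * π * (p.1 * w.fst + ⟪w.snd, p.2⟫) : ℝ) : ℂ) * Complex.I
  push_cast [smul_eq_mul]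
  ring

lemma conv_bound {V : Type*} [NormedAddCommGroup V] [InnerProductSpace ℝ V] [FiniteDimensional ℝ V]
    [MeasurableSpace V] [BorelSpace V] (A B : V → ℂ) (hA : Integrable A) (hB : Integrable B)
    (cB : Continuous B) (bB : ∃ C, ∀ x, ‖B x‖ ≤ C) (v : V) :
    ‖𝓕 (fun x => 𝓕⁻ A x * 𝓕⁻ B x) v‖ₑ ≤ ∫⁻ t, ‖A t‖ₑ * ‖B (v - t)‖ₑ := by
  set G : V → ℂ := convolution A B (ContinuousLinearMap.mul ℂ ℂ) volume with hG
  have hF : 𝓕⁻ G = fun x => 𝓕⁻ A x * 𝓕⁻ B x := by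
    ext x
    rw [Real.fourierInv_eq_fourier_neg, Real.fourierInv_eq_fourier_neg,
      Real.fourierInv_eq_fourier_neg, hG, Real.fourier_mul_convolution_eq hA hB]
  rw [← hF]
  by_cases hi : Integrable (𝓕⁻ G)
  · have hi' : Integrable (𝓕 G) := by
      have := hi.comp_neg
      simpa [Real.fourierInv_eq_fourier_neg] using this
    have cG : Continuous G := by
      refine BddAbove.continuous_convolution_right_of_integrable _ ?_ hA cB
      obtain ⟨C, hC⟩ := bB
      exact ⟨C, by rintro _ ⟨y, rfl⟩; exact hC y⟩
    have iG : Integrable G := hA.integrable_convolution _ hB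
    rw [cG.fourier_fourierInv_eq iG hi']
    rw [hG, convolution_def]
    refine (enorm_integral_le_lintegral_enorm _).trans (le_of_eq ?_)
    congr 1; ext t; simp
  · have : 𝓕 (𝓕⁻ G) v = 0 := by
      rw [Real.fourier_eq]
      apply integral_undef
      rw [Real.fourierIntegral_convergent_iff]
      exact hi
    rw [this]; simp

lemma ftST_mult_mul (m n : ℝ → V2 → ℂ) (φ ψ : ℝ × V2 → ℂ)
    (hA : Integrable (fun w : WW => m (2 * π * w.fst) ((2 * π) • w.snd) *
      ftST φ (2 * π * w.fst) ((2 * π) • w.snd)))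
    (hB : Integrable (fun w : WW => n (2 * π * w.fst) ((2 * π) • w.snd) *
      ftST ψ (2 * π * w.fst) ((2 * π) • w.snd)))
    (cB : Continuous (fun w : WW => n (2 * π * w.fst) ((2 * π) • w.snd) *
      ftST ψ (2 * π * w.fst) ((2 * π) • w.snd)))
    (bB : ∃ C, ∀ w : WW, ‖n (2 * π * w.fst) ((2 * π) • w.snd) *
      ftST ψ (2 * π * w.fst) ((2 * π) • w.snd)‖ ≤ C) (q : ℝ × V2) :
    ‖ftST (fun p => mult m φ p * mult n ψ p) q.1 q.2‖ₑ ≤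
      ∫⁻ p : ℝ × V2, ‖m p.1 p.2 * ftST φ p.1 p.2‖ₑ *
        ‖n (q - p).1 (q - p).2 * ftST ψ (q - p).1 (q - p).2‖ₑ := by
  rw [ftST_eq]
  have h1 := conv_bound _ _ hA hB cB bB ((2 * π)⁻¹ • WithLp.toLp 2 (q.1, q.2))
  simp only [mult, iftST_eq]
  refine h1.trans ?_
  have hpi : (0:ℝ) < 2 * π := by positivity
  rw [← (WithLp.volume_preserving_ofLp ℝ V2).lintegral_comp_emb
    (MeasurableEquiv.toLp 2 (ℝ × V2)).symm.measurableEmbedding]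
  set H : WW → ℝ≥0∞ := fun w => ‖m w.fst w.snd * ftST φ w.fst w.snd‖ₑ *
        ‖n (q - WithLp.ofLp w).1 (q - WithLp.ofLp w).2 * ftST ψ (q - WithLp.ofLp w).1 (q - WithLp.ofLp w).2‖ₑ with hH
  have e : ∀ w : WW, ‖m (2 * π * w.fst) ((2 * π) • w.snd) *
      ftST φ (2 * π * w.fst) ((2 * π) • w.snd)‖ₑ * ‖n (2 * π * ((2 * π)⁻¹ • WithLp.toLp 2 (q.1, q.2) - w : WW).fst) ((2 * π) • ((2 * π)⁻¹ • WithLp.toLp 2 (q.1, q.2) - w : WW).snd) *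
      ftST ψ (2 * π * ((2 * π)⁻¹ • WithLp.toLp 2 (q.1, q.2) - w : WW).fst) ((2 * π) • ((2 * π)⁻¹ • WithLp.toLp 2 (q.1, q.2) - w : WW).snd)‖ₑ = H ((2 * π) • w) := by
    intro w
    have e1 : 2 * π * ((2 * π)⁻¹ • WithLp.toLp 2 (q.1, q.2) - w : WW).fst = (q - WithLp.ofLp ((2 * π) • w)).1 := by
      change 2 * π * ((2 * π)⁻¹ * q.1 - w.fst) = q.1 - 2 * π * w.fst
      field_simp
    have e2 : (2 * π) • ((2 * π)⁻¹ • WithLp.toLp 2 (q.1, q.2) - w : WW).snd = (q - WithLp.ofLp ((2 * π) • w)).2 := by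
      change (2 * π) • ((2 * π)⁻¹ • q.2 - w.snd) = q.2 - (2 * π) • w.snd
      rw [smul_sub, smul_smul, mul_inv_cancel₀ hpi.ne', one_smul]
    rw [e1, e2]
    rfl
  simp_rw [e]
  change _ ≤ ∫⁻ w, H w
  have hm : MeasurableEmbedding (fun w : WW => (2 * π) • w) :=
    (Homeomorph.smulOfNeZero (2 * π) hpi.ne').measurableEmbedding
  rw [← hm.lintegral_map, Measure.map_addHaar_smul _ hpi.ne', lintegral_smul_measure]
  have hd : Module.finrank ℝ WW = 3 := by
    rw [(WithLp.linearEquiv 2 ℝ (ℝ × V2)).finrank_eq]; simp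
  rw [smul_eq_mul]
  refine mul_le_of_le_one_left (zero_le) ?_
  rw [ENNReal.ofReal_le_one, abs_of_pos (by positivity)]
  apply inv_le_one_of_one_le₀
  apply one_le_pow₀
  linarith [Real.pi_gt_three]

lemma ftST_schwartz (φ : SchwartzMap (ℝ × V2) ℂ) : ∃ Φ : SchwartzMap WW ℂ,
    ∀ w : WW, ftST φ (2 * π * w.fst) ((2 * π) • w.snd) = Φ w := by
  refine ⟨𝓕 (SchwartzMap.compCLMOfContinuousLinearEquiv ℂ
    (WithLp.prodContinuousLinearEquiv 2 ℝ ℝ V2) φ), fun w => ?_⟩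
  rw [ftST_eq, SchwartzMap.fourier_coe]
  have hpi : (0:ℝ) < 2 * π := by positivity
  have : (2 * π)⁻¹ • WithLp.toLp 2 (2 * π * w.fst, (2 * π) • w.snd) = w := by
    change (2 * π)⁻¹ • ((2 * π) • w) = w
    rw [smul_smul, inv_mul_cancel₀ hpi.ne', one_smul]
  rw [this]
  rfl

lemma ftST_continuous (φ : SchwartzMap (ℝ × V2) ℂ) :
    Continuous (fun q : ℝ × V2 => ftST φ q.1 q.2) := by
  obtain ⟨Φ, h⟩ := ftST_schwartz φ
  have hpi : (0:ℝ) < 2 * π := by positivity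
  have : (fun q : ℝ × V2 => ftST φ q.1 q.2) = fun q => Φ ((2 * π)⁻¹ • WithLp.toLp 2 q) := by
    ext q
    rw [← h]
    change _ = ftST φ (2 * π * ((2 * π)⁻¹ * q.1)) ((2 * π) • ((2 * π)⁻¹ • q.2))
    rw [smul_smul, ← mul_assoc, mul_inv_cancel₀ hpi.ne', one_smul, one_mul]
  rw [this]
  have c : Continuous (fun q : ℝ × V2 => (WithLp.toLp 2 q : WW)) :=
    WithLp.prod_continuous_toLp 2 ℝ V2
  exact Φ.continuous.comp (Continuous.const_smul c (2 * π)⁻¹)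

lemma mult_ok (m : ℝ → V2 → ℂ) (hm : Continuous (fun q : ℝ × V2 => m q.1 q.2))
    (hb : ∀ τ ξ, ‖m τ ξ‖ ≤ |τ| + ‖ξ‖) (φ : SchwartzMap (ℝ × V2) ℂ) :
    Continuous (fun w : WW => m (2 * π * w.fst) ((2 * π) • w.snd) *
      ftST φ (2 * π * w.fst) ((2 * π) • w.snd)) ∧
    Integrable (fun w : WW => m (2 * π * w.fst) ((2 * π) • w.snd) *
      ftST φ (2 * π * w.fst) ((2 * π) • w.snd)) ∧
    ∃ C, ∀ w : WW, ‖m (2 * π * w.fst) ((2 * π) • w.snd) *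
      ftST φ (2 * π * w.fst) ((2 * π) • w.snd)‖ ≤ C := by
  obtain ⟨Φ, h⟩ := ftST_schwartz φ
  simp_rw [h]
  have hpi : (0:ℝ) < 2 * π := by positivity
  have cc : Continuous (fun w : WW => m (2 * π * w.fst) ((2 * π) • w.snd)) := by
    have c : Continuous (fun w : WW => WithLp.ofLp w) := WithLp.prod_continuous_ofLp 2 ℝ V2
    exact hm.comp ((continuous_const.mul (continuous_fst.comp c)).prodMk
      (Continuous.const_smul (continuous_snd.comp c) (2 * π)))
  have hc : Continuous (fun w : WW => m (2 * π * w.fst) ((2 * π) • w.snd) * Φ w) :=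
    cc.mul Φ.continuous
  have bd : ∀ w : WW, ‖m (2 * π * w.fst) ((2 * π) • w.snd) * Φ w‖ ≤ 4 * π * (‖w‖ ^ 1 * ‖Φ w‖) := by
    intro w
    rw [norm_mul, ← mul_assoc]
    gcongr
    refine (hb _ _).trans ?_
    have h1 : ‖w.fst‖ ≤ ‖w‖ := WithLp.norm_fst_le _ w
    have h2 : ‖w.snd‖ ≤ ‖w‖ := WithLp.norm_snd_le _ w
    rw [norm_smul, abs_mul, Real.norm_eq_abs, abs_of_pos hpi]
    rw [Real.norm_eq_abs] at h1
    nlinarith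
  refine ⟨hc, ?_, ?_⟩
  · refine ((Φ.integrable_pow_mul volume 1).const_mul (4 * π)).mono' hc.aestronglyMeasurable ?_
    exact Filter.Eventually.of_forall bd
  · refine ⟨4 * π * SchwartzMap.seminorm ℝ 1 0 Φ, fun w => (bd w).trans ?_⟩
    gcongr
    exact Φ.norm_pow_mul_le_seminorm ℝ 1 w

instance haarST : (volume : Measure (ℝ × V2)).IsAddHaarMeasure := by
  rw [Measure.volume_eq_prod]; infer_instance

lemma ftST_dtime (φ : SchwartzMap (ℝ × V2) ℂ) (τ : ℝ) (ξ : V2) :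
    ftST (dtime φ) τ ξ = Complex.I * τ * ftST φ τ ξ := by
  set e : ℝ × V2 → ℂ := fun p => Complex.exp (-Complex.I * ((p.1 * τ + ⟪p.2, ξ⟫ : ℝ) : ℂ)) with he
  have hl : ∀ p : ℝ × V2, HasFDerivAt (fun p : ℝ × V2 => (p.1 * τ + ⟪p.2, ξ⟫ : ℝ))
      ((ContinuousLinearMap.fst ℝ ℝ V2).smulRight τ + (innerSL ℝ ξ).comp (ContinuousLinearMap.snd ℝ ℝ V2)) p := by
    intro p
    have := ((ContinuousLinearMap.fst ℝ ℝ V2).smulRight τ + (innerSL ℝ ξ).comp (ContinuousLinearMap.snd ℝ ℝ V2)).hasFDerivAt (x := p)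
    convert! this using 2
    simp [real_inner_comm]
  have hd : ∀ p, HasFDerivAt e (e p • (-Complex.I) • (Complex.ofRealCLM.comp ((ContinuousLinearMap.fst ℝ ℝ V2).smulRight τ + (innerSL ℝ ξ).comp (ContinuousLinearMap.snd ℝ ℝ V2)))) p := by
    intro p
    exact ((Complex.ofRealCLM.hasFDerivAt.comp p (hl p)).const_mul (-Complex.I)).cexp
  have hfe : ∀ p, fderiv ℝ e p ((1:ℝ), (0:V2)) = - (Complex.I * τ) * e p := by
    intro p
    rw [(hd p).fderiv]
    simp
    ring
  have ce : Continuous e := (continuous_iff_continuousAt.2 fun p => (hd p).continuousAt)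
  have ne : ∀ p, ‖e p‖ ≤ 1 := by
    intro p
    simp [he, Complex.norm_exp]
  have ie : ∀ g : ℝ × V2 → ℂ, Integrable g → Integrable (fun p => e p * g p) := by
    intro g hg
    exact hg.bdd_mul ce.aestronglyMeasurable (Filter.Eventually.of_forall ne)
  have iφ : Integrable (fun p => φ p) := φ.integrable
  have idφ : Integrable (fun p => fderiv ℝ φ p ((1:ℝ), (0:V2))) := by
    have := (SchwartzMap.fderivCLM ℝ (ℝ × V2) ℂ φ).integrable (μ := volume)
    exact this.apply_continuousLinearMap _
  have key := integral_mul_fderiv_eq_neg_fderiv_mul_of_integrable (μ := (volume : Measure (ℝ × V2)))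
    (f := e) (g := φ) (v := ((1:ℝ), (0:V2))) ?_ (ie _ idφ) (ie _ iφ)
    (fun p _ => (hd p).differentiableAt) (fun p _ => φ.differentiable p)
  · change ∫ p, e p * fderiv ℝ φ p ((1:ℝ), (0:V2)) = Complex.I * τ * ∫ p, e p * φ p
    rw [key, ← integral_const_mul, ← integral_neg]
    congr 1; ext p
    rw [hfe]; ring
  · simp_rw [hfe, mul_assoc]
    exact (ie _ iφ).const_mul _

lemma cs_sq {α : Type*} [MeasurableSpace α] (μ : Measure α) (f g : α → ℝ≥0∞) (hf : Measurable f)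
    (hg : Measurable g) : (∫⁻ a, f a * g a ∂μ) ^ 2 ≤ (∫⁻ a, f a ^ 2 ∂μ) * ∫⁻ a, g a ^ 2 ∂μ := by
  have h := ENNReal.lintegral_mul_le_Lp_mul_Lq μ Real.HolderConjugate.two_two hf.aemeasurable hg.aemeasurable
  have h2 := pow_le_pow_left₀ (zero_le) h 2
  refine h2.trans (le_of_eq ?_)
  rw [mul_pow, ← ENNReal.rpow_natCast, ← ENNReal.rpow_natCast, ← ENNReal.rpow_mul, ← ENNReal.rpow_mul]
  norm_num

/-- Abstract bilinear estimate. -/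
lemma bilin (K : ℝ × V2 → ℝ × V2 → ℝ≥0∞) (hK : ∀ q, Measurable (K q)) (M : ℝ≥0∞)
    (hM : ∀ q, ∫⁻ p, K q p ^ 2 ≤ M)
    (f g : ℝ × V2 → ℝ≥0∞) (hf : Measurable f) (hg : Measurable g) :
    ∫⁻ q, (∫⁻ p, K q p * (f p * g (q - p))) ^ 2 ≤ M * ((∫⁻ p, f p ^ 2) * ∫⁻ p, g p ^ 2) := by
  have h1 : ∀ q, (∫⁻ p, K q p * (f p * g (q - p))) ^ 2 ≤ M * ∫⁻ p, f p ^ 2 * g (q - p) ^ 2 := by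
    intro q
    refine (cs_sq _ _ _ (hK q) (hf.mul (hg.comp (measurable_const.sub measurable_id)))).trans ?_
    refine mul_le_mul' (hM q) (le_of_eq ?_)
    congr 1; ext p; exact mul_pow _ _ _
  have hme : Measurable (fun z : (ℝ × V2) × (ℝ × V2) => f z.2 ^ 2 * g (z.1 - z.2) ^ 2) := by fun_prop
  refine (lintegral_mono h1).trans ?_
  rw [lintegral_const_mul]
  swap
  · exact Measurable.lintegral_prod_right' hme
  gcongr
  rw [lintegral_lintegral_swap hme.aemeasurable]
  rw [← lintegral_mul_const _ (by fun_prop)]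
  refine lintegral_mono fun p => ?_
  rw [lintegral_const_mul _ (by fun_prop)]
  rw [lintegral_sub_right_eq_self (fun x => g x ^ 2) p]

lemma time_int (θ : ℝ) (r : ℝ) :
    ∫⁻ l : ℝ, ENNReal.ofReal ((1 + |(|l| - r)|) ^ (-(2 * θ))) ≤
      2 * ∫⁻ l : ℝ, ENNReal.ofReal ((1 + ‖l‖) ^ (-(2 * θ))) := by
  have h : ∀ l : ℝ, ENNReal.ofReal ((1 + |(|l| - r)|) ^ (-(2 * θ))) ≤
      ENNReal.ofReal ((1 + ‖l - r‖) ^ (-(2 * θ))) + ENNReal.ofReal ((1 + ‖l + r‖) ^ (-(2 * θ))) := by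
    intro l
    rcases abs_choice l with h | h
    · rw [h, Real.norm_eq_abs]; exact le_self_add
    · rw [h, ← abs_neg, show -(-l - r) = l + r by ring, Real.norm_eq_abs (l + r)]; exact le_add_self
  refine (lintegral_mono h).trans ?_
  rw [lintegral_add_left (by fun_prop)]
  rw [lintegral_sub_right_eq_self (fun x : ℝ => ENNReal.ofReal ((1 + ‖x‖) ^ (-(2 * θ)))) r,
   lintegral_add_right_eq_self (fun x : ℝ => ENNReal.ofReal ((1 + ‖x‖) ^ (-(2 * θ)))) r]
  exact (two_mul _).ge

/-- Japanese bracket. -/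
def jb (ξ : V2) : ℝ := (1 + ‖ξ‖ ^ 2) ^ ((1:ℝ) / 2)

lemma jb_pos (ξ : V2) : 0 < jb ξ := by unfold jb; positivity
lemma jb_sq (ξ : V2) : jb ξ ^ 2 = 1 + ‖ξ‖ ^ 2 := by
  rw [jb, ← Real.rpow_natCast, ← Real.rpow_mul (by positivity)]; norm_num
lemma jb_rpow (ξ : V2) (a : ℝ) : jb ξ ^ a = (1 + ‖ξ‖ ^ 2) ^ (a / 2) := by
  rw [jb, ← Real.rpow_mul (by positivity)]; congr 1; ring
lemma norm_le_jb (ξ : V2) : ‖ξ‖ ≤ jb ξ := by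
  nlinarith [jb_sq ξ, jb_pos ξ, norm_nonneg ξ]
lemma jb_add (ξ η : V2) : jb (ξ + η) ≤ jb ξ + jb η := by
  have h := norm_add_le ξ η
  have h2 : ‖ξ + η‖ ^ 2 ≤ (‖ξ‖ + ‖η‖) ^ 2 := by gcongr
  have h3 : ‖ξ‖ * ‖η‖ ≤ jb ξ * jb η :=
    mul_le_mul (norm_le_jb _) (norm_le_jb _) (norm_nonneg _) (jb_pos _).le
  refine le_of_sq_le_sq ?_ (add_pos (jb_pos _) (jb_pos _)).le
  nlinarith [jb_sq ξ, jb_sq η, jb_sq (ξ + η)]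
lemma jb_cont : Continuous jb := by
  unfold jb
  exact Continuous.rpow_const (by fun_prop) (fun x => Or.inr (by norm_num))

lemma space_int (σ : ℝ) (hσ : 1 < σ) :
    ∫⁻ η : V2, ENNReal.ofReal (jb η ^ (-(2 * σ))) < ∞ := by
  have := integrable_rpow_neg_one_add_norm_sq (E := V2) (μ := volume) (r := 2 * σ) (by simp; linarith)
  simp_rw [jb_rpow]
  exact this.lintegral_lt_top

/-- The kernel. -/
def ker (θ σ : ℝ) (q p : ℝ × V2) : ℝ :=
  (1 + |(|p.1| - ‖p.2‖)|) ^ (-θ) * (jb (q.2 - p.2) ^ (-σ) + jb p.2 ^ (-σ))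

lemma ker_int (θ σ : ℝ) (hθ : 1 / 2 < θ) (hσ : 1 < σ) : ∃ M : ℝ≥0∞, M ≠ ∞ ∧
    ∀ q, ∫⁻ p, ENNReal.ofReal (ker θ σ q p) ^ 2 ≤ M := by
  set T := ∫⁻ l : ℝ, ENNReal.ofReal ((1 + ‖l‖) ^ (-(2 * θ))) with hT
  set S := ∫⁻ η : V2, ENNReal.ofReal (jb η ^ (-(2 * σ))) with hS
  have Tfin : T < ∞ := finite_integral_one_add_norm (by simp; linarith)
  have Sfin : S < ∞ := space_int σ hσ
  have mj : Measurable jb := jb_cont.measurable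
  refine ⟨(2 * T) * (2 * (S + S)), ?_, fun q => ?_⟩
  · finiteness
  have hb : ∀ p : ℝ × V2, ENNReal.ofReal (ker θ σ q p) ^ 2 ≤
      ENNReal.ofReal ((1 + |(|p.1| - ‖p.2‖)|) ^ (-(2 * θ))) *
      (2 * (ENNReal.ofReal (jb (q.2 - p.2) ^ (-(2 * σ))) + ENNReal.ofReal (jb p.2 ^ (-(2 * σ))))) := by
    intro p
    have j1 := jb_pos (q.2 - p.2)
    have j2 := jb_pos p.2
    have hsq : ∀ x a : ℝ, 0 < x → x ^ (-(2 * a)) = (x ^ (-a)) ^ 2 := by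
      intro x a hx
      rw [← Real.rpow_natCast, ← Real.rpow_mul hx.le]; congr 1; push_cast; ring
    have e2 : ∀ x : ℝ, (2 : ℝ≥0∞) * ENNReal.ofReal x = ENNReal.ofReal (2 * x) := by
      intro x; rw [ENNReal.ofReal_mul (by norm_num)]; simp
    rw [← ENNReal.ofReal_add (by positivity) (by positivity), e2,
      ← ENNReal.ofReal_mul (by positivity), ← ENNReal.ofReal_pow (by unfold ker; positivity)]
    apply ENNReal.ofReal_le_ofReal
    rw [hsq _ _ j1, hsq _ _ j2, hsq _ θ (by positivity), ker, mul_pow]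
    gcongr
    nlinarith [sq_nonneg (jb (q.2 - p.2) ^ (-σ) - jb p.2 ^ (-σ))]
  refine (lintegral_mono hb).trans ?_
  rw [Measure.volume_eq_prod, lintegral_prod_symm _ (by fun_prop)]
  have hi : ∀ y : V2, ∫⁻ x : ℝ, ENNReal.ofReal ((1 + |(|x| - ‖y‖)|) ^ (-(2 * θ))) *
      (2 * (ENNReal.ofReal (jb (q.2 - y) ^ (-(2 * σ))) + ENNReal.ofReal (jb y ^ (-(2 * σ))))) ≤
      (2 * T) * (2 * (ENNReal.ofReal (jb (q.2 - y) ^ (-(2 * σ))) + ENNReal.ofReal (jb y ^ (-(2 * σ))))) := by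
    intro y
    rw [lintegral_mul_const _ (by fun_prop)]
    gcongr
    exact time_int θ _
  refine (lintegral_mono hi).trans ?_
  rw [lintegral_const_mul _ (by fun_prop), lintegral_const_mul _ (by fun_prop),
    lintegral_add_left (by fun_prop),
    lintegral_sub_left_eq_self (fun y => ENNReal.ofReal (jb y ^ (-(2 * σ)))) q.2]

/-- The combined weight of the `𝓗^{s+1,θ}` norm. -/
def nw (s θ : ℝ) (q : ℝ × V2) : ℝ :=
  jb q.2 ^ s * (jb q.2 + |q.1|) * (1 + |(|q.1| - ‖q.2‖)|) ^ θ

lemma nw_nonneg (s θ : ℝ) (q : ℝ × V2) : 0 ≤ nw s θ q := by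
  have := jb_pos q.2
  unfold nw; positivity

lemma HHN_bound (s θ : ℝ) (φ : SchwartzMap (ℝ × V2) ℂ) :
    ∫⁻ q : ℝ × V2, (ENNReal.ofReal (nw s θ q) * ‖ftST φ q.1 q.2‖ₑ) ^ 2 ≤
      2 * HHN (s + 1) θ φ ^ 2 := by
  set a := ∫⁻ q : ℝ × V2, (ENNReal.ofReal (wgt (s + 1) θ q.1 q.2) * (‖ftST φ q.1 q.2‖₊ : ℝ≥0∞)) ^ (2 : ℕ) with ha
  set b := ∫⁻ q : ℝ × V2, (ENNReal.ofReal (wgt s θ q.1 q.2) * (‖ftST (dtime φ) q.1 q.2‖₊ : ℝ≥0∞)) ^ (2 : ℕ) with hb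
  have hH : HHN (s + 1) θ φ = a ^ ((1:ℝ) / 2) + b ^ ((1:ℝ) / 2) := by
    rw [HHN, HN, HN, add_sub_cancel_right]
  have hsq : ∀ x : ℝ≥0∞, (x ^ ((1:ℝ) / 2)) ^ 2 = x := by
    intro x
    rw [← ENNReal.rpow_natCast, ← ENNReal.rpow_mul]; norm_num
  have h1 : a + b ≤ HHN (s + 1) θ φ ^ 2 := by
    rw [hH]
    calc a + b = (a ^ ((1:ℝ) / 2)) ^ 2 + (b ^ ((1:ℝ) / 2)) ^ 2 := by rw [hsq, hsq]
      _ ≤ _ := by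
        rw [add_sq]
        gcongr
        exact le_self_add
  refine le_trans ?_ (mul_le_mul_right h1 2)
  have mf : Measurable (fun q : ℝ × V2 => ftST φ q.1 q.2) := (ftST_continuous φ).measurable
  have mw : Measurable (fun q : ℝ × V2 => wgt (s + 1) θ q.1 q.2) := by unfold wgt; fun_prop
  rw [ha, hb, ← lintegral_add_left]
  swap
  · exact ((mw.ennreal_ofReal).mul mf.nnnorm.coe_nnreal_ennreal).pow_const 2
  rw [← lintegral_const_mul' _ _ (by norm_num)]
  refine lintegral_mono fun q => ?_
  have hj := jb_pos q.2
  have e1 : ENNReal.ofReal (nw s θ q) * ‖ftST φ q.1 q.2‖ₑ =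
      ENNReal.ofReal (wgt (s + 1) θ q.1 q.2 * ‖ftST φ q.1 q.2‖ + wgt s θ q.1 q.2 * ‖ftST (dtime φ) q.1 q.2‖) := by
    rw [← ofReal_norm, ← ENNReal.ofReal_mul (nw_nonneg _ _ _)]
    congr 1
    rw [ftST_dtime, nw, wgt, wgt, ← jb_rpow, ← jb_rpow, Real.rpow_add_one hj.ne']
    simp
    ring
  have e2 : ∀ x : ℝ, (2 : ℝ≥0∞) * ENNReal.ofReal x = ENNReal.ofReal (2 * x) := by
    intro x; rw [ENNReal.ofReal_mul (by norm_num)]; simp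
  have hw : ∀ a b, 0 ≤ wgt a b q.1 q.2 := fun a b => by unfold wgt; positivity
  have e3 : ∀ z : ℂ, (‖z‖₊ : ℝ≥0∞) = ENNReal.ofReal ‖z‖ := fun z => by rw [ofReal_norm]; rfl
  beta_reduce
  rw [e1, e3, e3, ← ENNReal.ofReal_mul (hw _ _), ← ENNReal.ofReal_mul (hw _ _)]
  have p1 := mul_nonneg (hw (s + 1) θ) (norm_nonneg (ftST φ q.1 q.2))
  have p2 := mul_nonneg (hw s θ) (norm_nonneg (ftST (dtime φ) q.1 q.2))
  rw [← ENNReal.ofReal_pow (add_nonneg p1 p2), ← ENNReal.ofReal_pow p1, ← ENNReal.ofReal_pow p2,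
    ← ENNReal.ofReal_add (by positivity) (by positivity), e2]
  apply ENNReal.ofReal_le_ofReal
  nlinarith [sq_nonneg (wgt (s + 1) θ q.1 q.2 * ‖ftST φ q.1 q.2‖ - wgt s θ q.1 q.2 * ‖ftST (dtime φ) q.1 q.2‖)]

lemma ptwise (s θ δ : ℝ) (hs : 0 < s) (hθ0 : 0 < θ) (hθ1 : θ < 1) (hδ : δ ≤ 0) (q p : ℝ × V2) :
    wgt s δ q.1 q.2 * ((|p.1| + ‖p.2‖) * |(|(q - p).1| - ‖(q - p).2‖)|) ≤
      2 ^ s * (ker θ (s + θ) q p * (nw s θ p * nw s θ (q - p))) := by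
  obtain ⟨r, hr⟩ : ∃ r, r = q - p := ⟨_, rfl⟩
  have hq : q.2 = p.2 + r.2 := by rw [hr]; simp
  have hk : ker θ (s + θ) q p = (1 + |(|p.1| - ‖p.2‖)|) ^ (-θ) * (jb r.2 ^ (-(s + θ)) + jb p.2 ^ (-(s + θ))) := by
    rw [ker, hr]; rfl
  rw [← hr, hk]
  set x := jb p.2 with hx
  set y := jb r.2 with hy
  have x0 : 0 < x := jb_pos _
  have y0 : 0 < y := jb_pos _
  set h := |(|r.1| - ‖r.2‖)| with hh
  have h0 : 0 ≤ h := abs_nonneg _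
  have w1 : wgt s δ q.1 q.2 ≤ (x + y) ^ s := by
    rw [wgt, ← jb_rpow, hq]
    have a1 : (1 + |(|q.1| - ‖p.2 + r.2‖)|) ^ δ ≤ 1 :=
      Real.rpow_le_one_of_one_le_of_nonpos (by linarith [abs_nonneg (|q.1| - ‖p.2 + r.2‖)]) hδ
    have a2 : jb (p.2 + r.2) ^ s ≤ (x + y) ^ s :=
      Real.rpow_le_rpow (jb_pos _).le (jb_add _ _) hs.le
    have a3 : 0 ≤ jb (p.2 + r.2) ^ s := Real.rpow_nonneg (jb_pos _).le _
    nlinarith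
  -- factor one
  have f1 : (|p.1| + ‖p.2‖) ≤ x ^ (-s) * (1 + |(|p.1| - ‖p.2‖)|) ^ (-θ) * nw s θ p := by
    have hp : 0 < 1 + |(|p.1| - ‖p.2‖)| := by positivity
    have : x ^ (-s) * (1 + |(|p.1| - ‖p.2‖)|) ^ (-θ) * nw s θ p = x + |p.1| := by
      rw [nw, ← hx, Real.rpow_neg x0.le, Real.rpow_neg hp.le]
      have := Real.rpow_pos_of_pos x0 s
      have := Real.rpow_pos_of_pos hp θ
      field_simp
    rw [this]
    linarith [norm_le_jb p.2]
  have f2 : h ≤ y ^ (-(s + θ)) * nw s θ r := by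
    have hn : ‖r.2‖ ≤ y := norm_le_jb _
    have hm : h ≤ y + |r.1| := by
      rw [hh, abs_le]; constructor <;> linarith [norm_nonneg r.2, abs_nonneg r.1]
    have : y ^ (-(s + θ)) * nw s θ r = y ^ (-θ) * ((y + |r.1|) * (1 + h) ^ θ) := by
      rw [nw, ← hy, ← hh, neg_add, Real.rpow_add y0, Real.rpow_neg y0.le s]
      have := Real.rpow_pos_of_pos y0 s
      field_simp
    rw [this, Real.rpow_neg y0.le, ← div_eq_inv_mul, le_div_iff₀ (Real.rpow_pos_of_pos y0 _)]
    set m := y + |r.1| with hmm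
    have m0 : 0 < m := by positivity
    calc h * y ^ θ = h ^ (1 - θ) * h ^ θ * y ^ θ := by
          rw [← Real.rpow_add_of_nonneg h0 (by linarith) hθ0.le]; simp
      _ ≤ m ^ (1 - θ) * (1 + h) ^ θ * m ^ θ := by
          have i1 : h ^ (1 - θ) ≤ m ^ (1 - θ) := Real.rpow_le_rpow h0 hm (by linarith)
          have i2 : h ^ θ ≤ (1 + h) ^ θ := Real.rpow_le_rpow h0 (by linarith) hθ0.le
          have i3 : y ^ θ ≤ m ^ θ := Real.rpow_le_rpow y0.le (by rw [hmm]; linarith [abs_nonneg r.1]) hθ0.le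
          gcongr
      _ = m ^ (1 - θ) * m ^ θ * (1 + h) ^ θ := by ring
      _ = m * (1 + h) ^ θ := by
          rw [← Real.rpow_add m0]; simp
  have f3 : (x + y) ^ s * (x ^ (-s) * y ^ (-(s + θ))) ≤ 2 ^ s * (y ^ (-(s + θ)) + x ^ (-(s + θ))) := by
    have px := Real.rpow_pos_of_pos x0 (-(s + θ))
    have py := Real.rpow_pos_of_pos y0 (-(s + θ))
    have p2 : (0:ℝ) < 2 ^ s := by positivity
    have cx : x ^ s * x ^ (-s) = 1 := by rw [← Real.rpow_add x0]; simp
    have cy : y ^ s * y ^ (-s) = 1 := by rw [← Real.rpow_add y0]; simp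
    rcases le_total y x with hxy | hxy
    · have a : (x + y) ^ s ≤ 2 ^ s * x ^ s := by
        rw [← Real.mul_rpow (by norm_num) x0.le]
        exact Real.rpow_le_rpow (by positivity) (by linarith) hs.le
      calc _ ≤ 2 ^ s * x ^ s * (x ^ (-s) * y ^ (-(s + θ))) := by gcongr
        _ = 2 ^ s * y ^ (-(s + θ)) * (x ^ s * x ^ (-s)) := by ring
        _ ≤ _ := by rw [cx]; nlinarith
    · have a : (x + y) ^ s ≤ 2 ^ s * y ^ s := by
        rw [← Real.mul_rpow (by norm_num) y0.le]
        exact Real.rpow_le_rpow (by positivity) (by linarith) hs.le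
      have b : y ^ (-θ) ≤ x ^ (-θ) := Real.rpow_le_rpow_of_nonpos x0 hxy (by linarith)
      calc _ ≤ 2 ^ s * y ^ s * (x ^ (-s) * y ^ (-(s + θ))) := by gcongr
        _ = 2 ^ s * x ^ (-s) * (y ^ s * y ^ (-s)) * y ^ (-θ) := by
            rw [neg_add, Real.rpow_add y0]; ring
        _ ≤ 2 ^ s * x ^ (-s) * 1 * x ^ (-θ) := by rw [cy]; gcongr
        _ = 2 ^ s * x ^ (-(s + θ)) := by rw [neg_add, Real.rpow_add x0]; ring
        _ ≤ _ := by nlinarith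
  have n1 := nw_nonneg s θ p
  have n2 := nw_nonneg s θ r
  have hwn : 0 ≤ wgt s δ q.1 q.2 := by unfold wgt; positivity
  calc _ ≤ (x + y) ^ s * ((x ^ (-s) * (1 + |(|p.1| - ‖p.2‖)|) ^ (-θ) * nw s θ p) * (y ^ (-(s + θ)) * nw s θ r)) := by
        gcongr
    _ = ((x + y) ^ s * (x ^ (-s) * y ^ (-(s + θ)))) * ((1 + |(|p.1| - ‖p.2‖)|) ^ (-θ) * (nw s θ p * nw s θ r)) := by ring
    _ ≤ (2 ^ s * (y ^ (-(s + θ)) + x ^ (-(s + θ)))) * ((1 + |(|p.1| - ‖p.2‖)|) ^ (-θ) * (nw s θ p * nw s θ r)) := by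
        gcongr
    _ = _ := by ring

/-- For `s > 0`, `max(1/2, 1-s) < θ < 1` and `0 ≤ ε ≤ 1-θ` there is a constant `C`
such that `‖D₊φ · D₋ψ‖_{H^{s,θ-1+ε}} ≤ C ‖φ‖_{𝓗^{s+1,θ}} ‖ψ‖_{𝓗^{s+1,θ}}`
for all Schwartz `φ, ψ` on `ℝ^{1+2}`. -/
theorem Dplus_Dminus_product_estimate (s θ ε : ℝ)
    (hs : 0 < s) (hθ1 : max (1 / 2) (1 - s) < θ) (hθ2 : θ < 1)
    (hε1 : 0 ≤ ε) (hε2 : ε ≤ 1 - θ) :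
    ∃ C : ℝ, 0 < C ∧
      ∀ φ ψ : SchwartzMap (ℝ × V2) ℂ,
        HN s (θ - 1 + ε) (fun p => Dplus ⇑φ p * Dminus ⇑ψ p) ≤
          ENNReal.ofReal C * (HHN (s + 1) θ ⇑φ * HHN (s + 1) θ ⇑ψ) := by
  obtain ⟨ha, hb⟩ := max_lt_iff.1 hθ1
  obtain ⟨M, hM, hK⟩ := ker_int θ (s + θ) ha (by linarith)
  set c : ℝ≥0∞ := ENNReal.ofReal (2 ^ s) with hc
  have hctop : c ≠ ∞ := ENNReal.ofReal_ne_top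
  set D : ℝ≥0∞ := c ^ 2 * M * 4 with hD
  have hDtop : D ^ ((1:ℝ) / 2) ≠ ∞ := by
    apply ENNReal.rpow_ne_top_of_nonneg (by norm_num)
    finiteness
  refine ⟨(D ^ ((1:ℝ) / 2)).toReal + 1, by positivity, fun φ ψ => ?_⟩
  have mj : Measurable jb := jb_cont.measurable
  have mn : Measurable (nw s θ) := by unfold nw; fun_prop
  set f : ℝ × V2 → ℝ≥0∞ := fun p => ENNReal.ofReal (nw s θ p) * ‖ftST φ p.1 p.2‖ₑ with hf
  set g : ℝ × V2 → ℝ≥0∞ := fun p => ENNReal.ofReal (nw s θ p) * ‖ftST ψ p.1 p.2‖ₑ with hg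
  have mf : Measurable f := mn.ennreal_ofReal.mul (ftST_continuous φ).measurable.enorm
  have mg : Measurable g := mn.ennreal_ofReal.mul (ftST_continuous ψ).measurable.enorm
  have mK : ∀ q, Measurable (fun p => ENNReal.ofReal (ker θ (s + θ) q p)) := by
    intro q; unfold ker; fun_prop
  have ef : ∀ z : ℝ, 0 ≤ z → ‖((z : ℝ) : ℂ)‖ₑ = ENNReal.ofReal z := by
    intro z hz
    rw [← ofReal_norm, Complex.norm_real, Real.norm_of_nonneg hz]
  have main : ∀ q : ℝ × V2, ENNReal.ofReal (wgt s (θ - 1 + ε) q.1 q.2) *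
      (‖ftST (fun p => Dplus ⇑φ p * Dminus ⇑ψ p) q.1 q.2‖₊ : ℝ≥0∞) ≤
      c * ∫⁻ p, ENNReal.ofReal (ker θ (s + θ) q p) * (f p * g (q - p)) := by
    intro q
    obtain ⟨-, hA, -⟩ := mult_ok (fun τ ξ => ((|τ| + ‖ξ‖ : ℝ) : ℂ)) (by fun_prop)
      (by intro τ ξ; rw [Complex.norm_real, Real.norm_of_nonneg (by positivity)]) φ
    obtain ⟨cB, hB, bB⟩ := mult_ok (fun τ ξ => ((|(|τ| - ‖ξ‖)| : ℝ) : ℂ)) (by fun_prop)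
      (by
        intro τ ξ
        rw [Complex.norm_real, Real.norm_of_nonneg (by positivity), abs_le]
        constructor <;> linarith [norm_nonneg ξ, abs_nonneg τ]) ψ
    have h1 := ftST_mult_mul (fun τ ξ => ((|τ| + ‖ξ‖ : ℝ) : ℂ))
      (fun τ ξ => ((|(|τ| - ‖ξ‖)| : ℝ) : ℂ)) φ ψ hA hB cB bB q
    change ‖ftST (fun p => Dplus ⇑φ p * Dminus ⇑ψ p) q.1 q.2‖ₑ ≤ _ at h1
    change _ * ‖ftST (fun p => Dplus ⇑φ p * Dminus ⇑ψ p) q.1 q.2‖ₑ ≤ _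
    refine (mul_le_mul_right h1 _).trans ?_
    rw [← lintegral_const_mul' _ _ ENNReal.ofReal_ne_top, ← lintegral_const_mul' _ _ hctop]
    refine lintegral_mono fun p => ?_
    have hpt := ENNReal.ofReal_le_ofReal
      (ptwise s θ (θ - 1 + ε) hs (by linarith) hθ2 (by linarith) q p)
    have hkn : 0 ≤ ker θ (s + θ) q p := by
      have := jb_pos (q.2 - p.2)
      have := jb_pos p.2
      unfold ker; positivity
    have hwn : 0 ≤ wgt s (θ - 1 + ε) q.1 q.2 := by unfold wgt; positivity
    rw [ENNReal.ofReal_mul hwn, ENNReal.ofReal_mul (by positivity), ENNReal.ofReal_mul (by positivity),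
      ENNReal.ofReal_mul hkn, ENNReal.ofReal_mul (nw_nonneg _ _ _)] at hpt
    simp only [enorm_mul, hf, hg]
    rw [ef _ (by positivity), ef _ (by positivity)]
    calc _ = (ENNReal.ofReal (wgt s (θ - 1 + ε) q.1 q.2) * (ENNReal.ofReal (|p.1| + ‖p.2‖) * ENNReal.ofReal |(|(q - p).1| - ‖(q - p).2‖)|)) * (‖ftST φ p.1 p.2‖ₑ * ‖ftST ψ (q - p).1 (q - p).2‖ₑ) := by ring
      _ ≤ _ := mul_le_mul_left hpt _
      _ = _ := by rw [hc]; ring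
  have h2 : ∫⁻ q : ℝ × V2, (ENNReal.ofReal (wgt s (θ - 1 + ε) q.1 q.2) *
      (‖ftST (fun p => Dplus ⇑φ p * Dminus ⇑ψ p) q.1 q.2‖₊ : ℝ≥0∞)) ^ (2 : ℕ) ≤
      D * (HHN (s + 1) θ ⇑φ * HHN (s + 1) θ ⇑ψ) ^ 2 := by
    calc _ ≤ ∫⁻ q : ℝ × V2, (c * ∫⁻ p, ENNReal.ofReal (ker θ (s + θ) q p) * (f p * g (q - p))) ^ 2 :=
          lintegral_mono fun q => pow_le_pow_left₀ zero_le (main q) 2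
      _ = c ^ 2 * ∫⁻ q : ℝ × V2, (∫⁻ p, ENNReal.ofReal (ker θ (s + θ) q p) * (f p * g (q - p))) ^ 2 := by
          rw [← lintegral_const_mul' _ _ (by finiteness)]
          congr 1; ext q; exact mul_pow _ _ _
      _ ≤ c ^ 2 * (M * ((∫⁻ p, f p ^ 2) * ∫⁻ p, g p ^ 2)) :=
          mul_le_mul_right (bilin _ mK M hK f g mf mg) _
      _ ≤ c ^ 2 * (M * ((2 * HHN (s + 1) θ ⇑φ ^ 2) * (2 * HHN (s + 1) θ ⇑ψ ^ 2))) := by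
          gcongr
          · exact HHN_bound s θ φ
          · exact HHN_bound s θ ψ
      _ = _ := by rw [hD]; ring
  rw [HN]
  calc _ ≤ (D * (HHN (s + 1) θ ⇑φ * HHN (s + 1) θ ⇑ψ) ^ 2) ^ ((1:ℝ) / 2) :=
        ENNReal.rpow_le_rpow h2 (by norm_num)
    _ = D ^ ((1:ℝ) / 2) * (HHN (s + 1) θ ⇑φ * HHN (s + 1) θ ⇑ψ) := by
        rw [ENNReal.mul_rpow_of_nonneg _ _ (by norm_num)]
        congr 1
        rw [← ENNReal.rpow_natCast, ← ENNReal.rpow_mul]; norm_num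
    _ ≤ _ := by
        refine mul_le_mul_left ?_ _
        rw [ENNReal.le_ofReal_iff_toReal_le hDtop (by positivity)]
        linarith
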